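/- Let A ∈ ℂ^{n×m}, let λ₀, λ₁ ∈ ℂⁿ with every entry of λ₁ nonzero, and let X₀, X₁ ∈ ℂ^{m×N} with X₀ ≠ 0 and N ≥ 2. Suppose diag(λ₁)·A·X₁ = diag(λ₀)·A·X₀. Let v ∈ ℂ^{mN} be the orthogonal projection of vec(X₁) onto the orthogonal complement of vec(X₀), i.e., v = vec(X₁) − (⟨vec(X₀), vec(X₁)⟩ / ‖vec(X₀)‖²)·vec(X₀). Then M(A, X₀)·v = 0. -/

import Mathlib

open MeasureTheory Matrix

noncomputable section

/-- The `(N-1) × N` matrix `B(a,X)`: for `j = 0,…,N-2` (0-indexed), entry `(j,0)` is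
`-(a · X^{(:,j+1)})`, entry `(j,j+1)` is `a · X^{(:,0)}`, all other entries zero. -/
def Bmat {m N : ℕ} (a : Fin m → ℂ) (X : Matrix (Fin m) (Fin N) ℂ) :
    Matrix (Fin (N - 1)) (Fin N) ℂ :=
  Matrix.of fun j k =>
    if (k : ℕ) = 0 then
      -(a ⬝ᵥ fun i => X i ⟨(j : ℕ) + 1, by have := j.isLt; omega⟩)
    else if (k : ℕ) = (j : ℕ) + 1 then
      a ⬝ᵥ fun i => X i ⟨0, by have := j.isLt; omega⟩
    else 0

/-- Column-wise vectorization of `X`, indexed by (column, row). -/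
def vecM {m N : ℕ} (X : Matrix (Fin m) (Fin N) ℂ) : Fin N × Fin m → ℂ :=
  fun p => X p.2 p.1

/-- `D(a,X) = B(a,X) ⊗ a`, an `(N-1) × mN` matrix, columns indexed compatibly with `vecM`. -/
def Dsmall {m N : ℕ} (a : Fin m → ℂ) (X : Matrix (Fin m) (Fin N) ℂ) :
    Matrix (Fin (N - 1)) (Fin N × Fin m) ℂ :=
  Matrix.of fun j p => Bmat a X j p.1 * a p.2

/-- `D(A,X)`: vertical stack of `D(A^{(k,:)},X)` over the rows `k` of `A`. -/
def Dbig {n m N : ℕ} (A : Matrix (Fin n) (Fin m) ℂ) (X : Matrix (Fin m) (Fin N) ℂ) :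
    Matrix (Fin n × Fin (N - 1)) (Fin N × Fin m) ℂ :=
  Matrix.of fun q p => Dsmall (A q.1) X q.2 p

/-- `M(A,X)`: the row `vec(X)^*` stacked on top of `D(A,X)`. -/
def Mmat {n m N : ℕ} (A : Matrix (Fin n) (Fin m) ℂ) (X : Matrix (Fin m) (Fin N) ℂ) :
    Matrix (Unit ⊕ Fin n × Fin (N - 1)) (Fin N × Fin m) ℂ :=
  Matrix.of fun q p =>
    match q with
    | Sum.inl _ => star (vecM X p)
    | Sum.inr r => Dbig A X r p

lemma Bmat_mulVec {m N : ℕ} (a : Fin m → ℂ) (X : Matrix (Fin m) (Fin N) ℂ) (w : Fin N → ℂ)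
    (j : Fin (N - 1)) (c₀ c₁ : Fin N) (h₀ : (c₀ : ℕ) = 0) (h₁ : (c₁ : ℕ) = (j : ℕ) + 1) :
    (Bmat a X *ᵥ w) j =
      (a ⬝ᵥ fun i => X i c₀) * w c₁ - (a ⬝ᵥ fun i => X i c₁) * w c₀ := by
  have hne : c₁ ≠ c₀ := fun h => by have := congrArg Fin.val h; omega
  have e₀ : (⟨0, by omega⟩ : Fin N) = c₀ := Fin.ext h₀.symm
  have e₁ : (⟨(j : ℕ) + 1, by omega⟩ : Fin N) = c₁ := Fin.ext h₁.symm
  have hB : ∀ k, Bmat a X j k * w k = (if k = c₁ then (a ⬝ᵥ fun i => X i c₀) * w c₁ else 0)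
      + (if k = c₀ then -((a ⬝ᵥ fun i => X i c₁) * w c₀) else 0) := by
    intro k
    by_cases hk₀ : k = c₀
    · subst hk₀
      simp [Bmat, h₀, e₁, hne.symm]
    · have hk : (k : ℕ) ≠ 0 := fun h => hk₀ (Fin.ext (h.trans h₀.symm))
      by_cases hk₁ : k = c₁
      · subst hk₁
        simp [Bmat, h₁, e₀, hk₀]
      · have hk' : (k : ℕ) ≠ (j : ℕ) + 1 := fun h => hk₁ (Fin.ext (h.trans h₁.symm))
        simp only [Bmat, Matrix.of_apply, if_neg hk, if_neg hk', if_neg hk₀, if_neg hk₁]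
        simp
  simp only [Matrix.mulVec, dotProduct] at hB ⊢
  rw [Finset.sum_congr rfl fun k _ => hB k, Finset.sum_add_distrib]
  simp [sub_eq_add_neg]

lemma Dbig_mulVec_vecM {n m N : ℕ} (A : Matrix (Fin n) (Fin m) ℂ)
    (X Y : Matrix (Fin m) (Fin N) ℂ) (k : Fin n) (j : Fin (N - 1)) :
    (Dbig A X *ᵥ vecM Y) (k, j) = (Bmat (A k) X *ᵥ (A * Y) k) j := by
  simp only [Matrix.mulVec, dotProduct, Fintype.sum_prod_type, Dbig, Dsmall, vecM,
    Matrix.of_apply, Matrix.mul_apply, Finset.mul_sum, mul_assoc]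

open scoped ComplexOrder in
lemma sum_star_vecM_mul_self_ne_zero {m N : ℕ} {X : Matrix (Fin m) (Fin N) ℂ} (hX : X ≠ 0) :
    ∑ q : Fin N × Fin m, star (vecM X q) * vecM X q ≠ 0 := by
  intro h
  have hv : vecM X = 0 := dotProduct_star_self_eq_zero.mp h
  exact hX (Matrix.ext fun i k => congrFun hv (k, i))

/-- If `diag(λ₁) A X₁ = diag(λ₀) A X₀` with all entries of `λ₁` nonzero and `X₀ ≠ 0`, then the
orthogonal projection of `vec(X₁)` onto the orthogonal complement of `vec(X₀)` lies in the
null space of `M(A, X₀)`. -/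
theorem stmt15 {n m N : ℕ} (hN : 2 ≤ N) (A : Matrix (Fin n) (Fin m) ℂ)
    (lam0 lam1 : Fin n → ℂ) (hlam1 : ∀ k, lam1 k ≠ 0)
    (X0 X1 : Matrix (Fin m) (Fin N) ℂ) (hX0 : X0 ≠ 0)
    (heq : Matrix.diagonal lam1 * A * X1 = Matrix.diagonal lam0 * A * X0) :
    Mmat A X0 *ᵥ
      (fun p : Fin N × Fin m => vecM X1 p -
        ((∑ q : Fin N × Fin m, star (vecM X0 q) * vecM X1 q) /
          (∑ q : Fin N × Fin m, star (vecM X0 q) * vecM X0 q)) * vecM X0 p) = 0 := by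
  set c := (∑ q : Fin N × Fin m, star (vecM X0 q) * vecM X1 q) /
    (∑ q : Fin N × Fin m, star (vecM X0 q) * vecM X0 q) with hc
  ext q
  rcases q with _ | ⟨k, j⟩
  · simp only [Matrix.mulVec, dotProduct, Mmat, Matrix.of_apply, mul_sub, Finset.sum_sub_distrib,
      mul_left_comm _ c, ← Finset.mul_sum, Pi.zero_apply]
    rw [hc, div_mul_cancel₀ _ (sum_star_vecM_mul_self_ne_zero hX0), sub_self]
  · change (Dbig A X0 *ᵥ vecM (X1 - c • X0)) (k, j) = 0
    have hrow : ∀ l, (A * X1) k l = lam0 k / lam1 k * (A * X0) k l := by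
      intro l
      have h := congrFun (congrFun heq k) l
      rw [Matrix.mul_assoc, Matrix.mul_assoc, Matrix.diagonal_mul, Matrix.diagonal_mul] at h
      field_simp [hlam1 k]
      linear_combination h
    have hj := j.isLt
    rw [Dbig_mulVec_vecM, Bmat_mulVec (A k) X0 _ j ⟨0, by omega⟩ ⟨j + 1, by omega⟩ rfl rfl]
    have hdot : ∀ l, (A k ⬝ᵥ fun i => X0 i l) = (A * X0) k l := fun _ => rfl
    simp only [hdot, Matrix.mul_sub, Matrix.mul_smul, Matrix.sub_apply, Matrix.smul_apply, hrow,
      smul_eq_mul]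
    ring
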